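/- For every integer k ≥ 3 and every real c > 0 there exists n₀ such that for every integer n ≥ n₀, every set A of n distinct real numbers with |A - A| ≤ c·n contains a k-term arithmetic progression; that is, there exist a ∈ ℝ and a real δ > 0 such that a, a+δ, a+2δ, ..., a+(k-1)δ all belong to A. -/

import Mathlib

open Finset Pointwise

/-- The (positive) difference set of a finite set of reals:
`A - A = {a - a' : a, a' ∈ A, a - a' > 0}`. -/
noncomputable def diffSet (A : Finset ℝ) : Finset ℝ := (A - A).filter (fun x => 0 < x)

/-! ### Averages over finite types -/

section Average

variable {X Y T : Type*}

/-- The average of a real function over a finite type. -/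
noncomputable def avg (f : X → ℝ) : ℝ := (∑ᶠ x, f x) / Nat.card X

/-- The indicator function of a set. -/
noncomputable def ind (A : Set X) (x : X) : ℝ := A.indicator 1 x

theorem avg_eq_sum [Fintype X] (f : X → ℝ) : avg f = (∑ x, f x) / Fintype.card X := by
  rw [avg, finsum_eq_sum_of_fintype, Nat.card_eq_fintype_card]

theorem ind_of_mem {A : Set X} {x : X} (h : x ∈ A) : ind A x = 1 := by simp [ind, h]

theorem ind_of_notMem {A : Set X} {x : X} (h : x ∉ A) : ind A x = 0 := by simp [ind, h]

theorem ind_nonneg (A : Set X) (x : X) : 0 ≤ ind A x := by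
  by_cases h : x ∈ A <;> simp [ind, h]

theorem ind_le_one (A : Set X) (x : X) : ind A x ≤ 1 := by
  by_cases h : x ∈ A <;> simp [ind, h]

theorem ind_compl (A : Set X) (x : X) : ind Aᶜ x = 1 - ind A x := by
  by_cases h : x ∈ A <;> simp [ind, h]

variable [Finite X] [Finite Y]

theorem avg_mono {f g : X → ℝ} (h : ∀ x, f x ≤ g x) : avg f ≤ avg g := by
  have := Fintype.ofFinite X
  rw [avg_eq_sum, avg_eq_sum]
  gcongr
  exact h _

theorem avg_const [Nonempty X] (c : ℝ) : avg (fun _ : X => c) = c := by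
  have := Fintype.ofFinite X
  rw [avg_eq_sum]
  simp

theorem avg_add (f g : X → ℝ) : avg (fun x => f x + g x) = avg f + avg g := by
  have := Fintype.ofFinite X
  simp only [avg_eq_sum, Finset.sum_add_distrib, add_div]

theorem avg_sub (f g : X → ℝ) : avg (fun x => f x - g x) = avg f - avg g := by
  have := Fintype.ofFinite X
  simp only [avg_eq_sum, Finset.sum_sub_distrib, sub_div]

theorem avg_const_mul (c : ℝ) (f : X → ℝ) : avg (fun x => c * f x) = c * avg f := by
  have := Fintype.ofFinite X
  simp only [avg_eq_sum, ← Finset.mul_sum, mul_div_assoc]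

theorem avg_sum (s : Finset T) (f : T → X → ℝ) :
    avg (fun x => ∑ t ∈ s, f t x) = ∑ t ∈ s, avg (f t) := by
  have := Fintype.ofFinite X
  simp only [avg_eq_sum]
  rw [Finset.sum_comm, Finset.sum_div]

theorem avg_equiv (e : X ≃ Y) (f : Y → ℝ) : avg (fun x => f (e x)) = avg f := by
  have := Fintype.ofFinite X
  have := Fintype.ofFinite Y
  rw [avg_eq_sum, avg_eq_sum, Fintype.card_congr e, e.sum_comp]

theorem avg_prod (f : X × Y → ℝ) : avg f = avg fun x => avg fun y => f (x, y) := by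
  have := Fintype.ofFinite X
  have := Fintype.ofFinite Y
  simp only [avg_eq_sum, Fintype.sum_prod_type, Fintype.card_prod, Nat.cast_mul]
  rw [← Finset.sum_div, div_div, mul_comm]

theorem avg_comm (f : X → Y → ℝ) :
    (avg fun x => avg fun y => f x y) = avg fun y => avg fun x => f x y := by
  rw [← avg_prod fun p : X × Y => f p.1 p.2, ← avg_prod fun p : Y × X => f p.2 p.1]
  exact avg_equiv (Equiv.prodComm X Y) fun p => f p.2 p.1

theorem avg_nonneg {f : X → ℝ} (h : ∀ x, 0 ≤ f x) : 0 ≤ avg f := by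
  have := Fintype.ofFinite X
  rw [avg_eq_sum]
  have := Finset.sum_nonneg fun x (_ : x ∈ Finset.univ) => h x
  positivity

theorem avg_le_of_le [Nonempty X] {f : X → ℝ} {c : ℝ} (h : ∀ x, f x ≤ c) : avg f ≤ c :=
  (avg_mono h).trans_eq (avg_const c)

theorem le_avg_of_le [Nonempty X] {f : X → ℝ} {c : ℝ} (h : ∀ x, c ≤ f x) : c ≤ avg f :=
  (avg_const c).symm.trans_le (avg_mono h)

theorem exists_avg_le [Nonempty X] (f : X → ℝ) : ∃ x, avg f ≤ f x := by
  obtain ⟨x, hx⟩ := Finite.exists_max f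
  exact ⟨x, avg_le_of_le hx⟩

theorem le_card_mul_avg {f : X → ℝ} (h : ∀ x, 0 ≤ f x) (x : X) : f x ≤ Nat.card X * avg f := by
  have := Fintype.ofFinite X
  have : Nonempty X := ⟨x⟩
  rw [avg_eq_sum, Nat.card_eq_fintype_card, mul_div_cancel₀ _ (by simp)]
  exact Finset.single_le_sum (fun y _ => h y) (Finset.mem_univ x)

/-- Resampling part of a uniform random variable does not change its distribution. -/
theorem avg_resample [Nonempty Y] (g : X × Y → X × Y) (hg : Function.Involutive g) (f : X → ℝ) :
    avg f = avg fun x => avg fun y => f (g (x, y)).1 := by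
  rw [← avg_prod fun p : X × Y => f (g p).1]
  refine Eq.trans ?_ (avg_equiv hg.toPerm fun p : X × Y => f p.1).symm
  simp only [avg_prod, avg_const]

theorem avg_sum_arrow {ι κ : Type*} {α : Type*} [Finite ι] [Finite κ] [Finite α]
    (f : (ι ⊕ κ → α) → ℝ) : avg f = avg fun u => avg fun v => f (Sum.elim u v) := by
  rw [← avg_equiv (Equiv.sumArrowEquivProdArrow ι κ α).symm f, avg_prod]
  rfl

theorem avg_arrow_congr {ι κ : Type*} {α : Type*} [Finite ι] [Finite κ] [Finite α] (e : ι ≃ κ)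
    (f : (ι → α) → ℝ) : (avg fun x : κ → α => f (x ∘ e)) = avg f :=
  avg_equiv (e.symm.arrowCongr (Equiv.refl α)) f

theorem avg_pi_prod {ι α : Type*} [Fintype ι] [Finite α] (g : α → ℝ) :
    (avg fun x : ι → α => ∏ i, g (x i)) = avg g ^ Fintype.card ι := by
  classical
  have := Fintype.ofFinite α
  have key : (∑ a, g a) ^ Fintype.card ι = ∑ x : ι → α, ∏ i, g (x i) := by
    rw [← Finset.card_univ, ← Finset.prod_const, Finset.prod_univ_sum, Fintype.piFinset_univ]
  rw [avg_eq_sum, avg_eq_sum, div_pow, Fintype.card_fun, Nat.cast_pow, key]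

theorem avg_range {f : Y → ℝ} {V : X → Y} (hV : V.Injective) (h : (avg fun x => f (V x)) ≤ 0) :
    (avg fun y => ind (Set.range V) y * f y) ≤ 0 := by
  classical
  have := Fintype.ofFinite X
  have := Fintype.ofFinite Y
  rw [avg_eq_sum] at h ⊢
  have key : ∑ y, ind (Set.range V) y * f y = ∑ x, f (V x) := by
    rw [← Finset.sum_image (f := f) (s := Finset.univ) (g := V) hV.injOn,
      ← Finset.sum_filter_add_sum_filter_not Finset.univ (· ∈ Set.range V)]
    rw [Finset.sum_congr rfl (g := f) (fun y hy => by
        rw [ind_of_mem (Finset.mem_filter.1 hy).2, one_mul]),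
      Finset.sum_eq_zero (s := Finset.univ.filter (· ∉ Set.range V)) (fun y hy => by
        rw [ind_of_notMem (Finset.mem_filter.1 hy).2, zero_mul]), add_zero]
    congr 1
    ext
    simp
  rw [key]
  rcases isEmpty_or_nonempty X with hX | hX
  · simp
  · have hc : (0 : ℝ) < Fintype.card X := by exact_mod_cast Fintype.card_pos
    rw [div_le_iff₀ hc, zero_mul] at h
    exact div_nonpos_of_nonpos_of_nonneg h (by positivity)

/-- If every point where `f` exceeds `ε` lies in one of finitely many sets, then one of these sets
is large. -/
theorem exists_popular [Finite T] [Nonempty T] [Nonempty Y] {f : Y → ℝ} {ε : ℝ} (hf : ∀ y, f y ≤ 1)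
    (hε : 0 ≤ ε) (P : T → Set Y) (h : ∀ y, ε < f y → ∃ t, y ∈ P t) :
    ∃ t, avg f ≤ ε + Nat.card T * avg (ind (P t)) := by
  have := Fintype.ofFinite T
  obtain ⟨t, ht⟩ := Finite.exists_max fun t => avg (ind (P t))
  refine ⟨t, ?_⟩
  calc avg f ≤ avg fun y => ε + ∑ t, ind (P t) y := by
        refine avg_mono fun y => ?_
        have h0 : 0 ≤ ∑ t, ind (P t) y := Finset.sum_nonneg fun t _ => ind_nonneg _ _
        by_cases hy : ε < f y
        · obtain ⟨s, hs⟩ := h y hy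
          have h1 : ind (P s) y ≤ ∑ t, ind (P t) y :=
            Finset.single_le_sum (f := fun t => ind (P t) y) (fun t _ => ind_nonneg _ _)
              (Finset.mem_univ s)
          rw [ind_of_mem hs] at h1
          linarith [hf y]
        · linarith
    _ = ε + ∑ t, avg (ind (P t)) := by rw [avg_add, avg_const, avg_sum]
    _ ≤ ε + Nat.card T * avg (ind (P t)) := by
        gcongr
        rw [Nat.card_eq_fintype_card, ← nsmul_eq_mul]
        exact Finset.sum_le_card_nsmul _ _ _ fun s _ => ht s

end Average

/-! ### Combinatorial lines and subspaces -/

section Subspaces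

open Combinatorics

variable {α ι κ η θ : Type}

instance [Finite α] [Finite ι] : Finite (Line α ι) :=
  Finite.of_injective Line.idxFun fun _ _ h => Line.ext h

instance [Finite α] [Finite ι] [Finite η] : Finite (Subspace η α ι) :=
  Finite.of_injective Subspace.idxFun fun _ _ h => Subspace.ext h

/-- The image of a line under a subspace. -/
def Combinatorics.Subspace.mapLine (W : Subspace η α ι) (l : Line α η) : Line α ι where
  idxFun i := (W.idxFun i).elim some l.idxFun
  proper := by
    obtain ⟨e, he⟩ := l.proper
    obtain ⟨i, hi⟩ := W.proper e
    exact ⟨i, by simp [hi, he]⟩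

theorem Combinatorics.Subspace.mapLine_apply (W : Subspace η α ι) (l : Line α η) (a : α) :
    W.mapLine l a = W (l a) := by
  ext i
  cases h : W.idxFun i <;> simp [Subspace.mapLine, Subspace.coe_apply, h]

/-- The image of a subspace under a subspace. -/
def Combinatorics.Subspace.comp (W : Subspace η α ι) (V : Subspace θ α η) : Subspace θ α ι where
  idxFun i := (W.idxFun i).elim Sum.inl V.idxFun
  proper e := by
    obtain ⟨j, hj⟩ := V.proper e
    obtain ⟨i, hi⟩ := W.proper j
    exact ⟨i, by simp [hi, hj]⟩

theorem Combinatorics.Subspace.comp_apply (W : Subspace η α ι) (V : Subspace θ α η) (x : θ → α) :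
    W.comp V x = W (V x) := by
  ext i
  cases h : W.idxFun i <;> simp [Subspace.comp, Subspace.coe_apply, h]

theorem Combinatorics.Subspace.apply_injective (V : Subspace η α ι) : Function.Injective V :=
  fun x y hxy => funext fun e => by
    obtain ⟨i, hi⟩ := V.proper e
    rw [← V.apply_inr (x := x) hi, hxy, V.apply_inr hi]

/-- The subspace obtained by prescribing additional coordinates on the right. -/
def Combinatorics.Subspace.horizontal (V : Subspace η α ι) (y : κ → α) :
    Subspace η α (ι ⊕ κ) where
  idxFun := Sum.elim V.idxFun (Sum.inl ∘ y)
  proper e := by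
    obtain ⟨j, hj⟩ := V.proper e
    exact ⟨Sum.inl j, hj⟩

theorem Combinatorics.Subspace.horizontal_apply (V : Subspace η α ι) (y : κ → α) (x : η → α) :
    V.horizontal y x = Sum.elim (V x) y := by
  ext i
  cases i <;> rfl

/-- The subspace obtained by prescribing additional coordinates on the left. -/
def Combinatorics.Subspace.vertical (y : κ → α) (V : Subspace η α ι) :
    Subspace η α (κ ⊕ ι) where
  idxFun := Sum.elim (Sum.inl ∘ y) V.idxFun
  proper e := by
    obtain ⟨j, hj⟩ := V.proper e
    exact ⟨Sum.inr j, hj⟩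

theorem Combinatorics.Subspace.vertical_apply (y : κ → α) (V : Subspace η α ι) (x : η → α) :
    V.vertical y x = Sum.elim y (V x) := by
  ext i
  cases i <;> rfl

/-- The product of a subspace and a line. -/
def Combinatorics.Subspace.prodLine {d : ℕ} (V : Subspace (Fin d) α ι) (l : Line α κ) :
    Subspace (Fin (d + 1)) α (ι ⊕ κ) where
  idxFun := Sum.elim (fun j => (V.idxFun j).map id Fin.succ)
    fun i => (l.idxFun i).elim (Sum.inr 0) Sum.inl
  proper e := by
    refine Fin.cases ?_ (fun e => ?_) e
    · obtain ⟨i, hi⟩ := l.proper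
      exact ⟨Sum.inr i, by simp [hi]⟩
    · obtain ⟨j, hj⟩ := V.proper e
      exact ⟨Sum.inl j, by simp [hj]⟩

theorem Combinatorics.Subspace.prodLine_apply {d : ℕ} (V : Subspace (Fin d) α ι) (l : Line α κ)
    (x : Fin (d + 1) → α) : V.prodLine l x = Sum.elim (V (x ∘ Fin.succ)) (l (x 0)) := by
  ext i
  rcases i with j | i
  · cases h : V.idxFun j <;> simp [Subspace.prodLine, Subspace.coe_apply, h]
  · cases h : l.idxFun i <;> simp [Subspace.prodLine, Subspace.coe_apply, h]

/-! ### Insensitive sets -/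

/-- Collapse the letter `none` to the letter `a`. A set of words over `Option α` is insensitive to
exchanging `a` and `none` iff it is a preimage under this map. -/
def collapse (a : α) (x : ι → Option α) : ι → α := fun i => (x i).getD a

theorem collapse_elim (a : α) (x : κ → Option α) (y : ι → Option α) :
    collapse a (Sum.elim x y) = Sum.elim (collapse a x) (collapse a y) := by
  ext i
  cases i <;> rfl

/-- Erase the letters of `w` at the positions where `b` is `none`. -/
def mask (b : ι → Option α) (w : ι → α) : ι → Option α := fun i => (b i).map fun _ => w i

/-! ### The density Hales-Jewett property -/

/-- A set of words is line-free if it contains no combinatorial line. -/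
def LineFree (A : Set (ι → α)) : Prop := ∀ l : Line α ι, ∃ a, l a ∉ A

/-- Every line-free set of words indexed by `ι` has density at most `δ`. -/
def DensLE (α ι : Type) (δ : ℝ) : Prop := ∀ A : Set (ι → α), LineFree A → avg (ind A) ≤ δ

/-- The density Hales-Jewett property of an alphabet. -/
def DHJ (α : Type) : Prop := ∀ δ : ℝ, 0 < δ → ∃ n : ℕ, DensLE α (Fin n) δ

theorem LineFree.subspace {A : Set (ι → α)} (hA : LineFree A) (W : Subspace η α ι) :
    LineFree {x | W x ∈ A} := fun l => by
  obtain ⟨a, ha⟩ := hA (W.mapLine l)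
  exact ⟨a, by rwa [W.mapLine_apply] at ha⟩

theorem LineFree.fiber {A : Set (κ ⊕ ι → α)} (hA : LineFree A) (u : κ → α) :
    LineFree {v : ι → α | Sum.elim u v ∈ A} := fun l => by
  obtain ⟨a, ha⟩ := hA (l.vertical u)
  exact ⟨a, by rwa [Line.vertical_apply] at ha⟩

theorem DensLE.mono {δ ε : ℝ} (h : DensLE α ι δ) (hδ : δ ≤ ε) : DensLE α ι ε :=
  fun A hA => (h A hA).trans hδ

variable [Finite α] [Finite ι] [Finite κ]

theorem DensLE.sum [Nonempty α] {δ : ℝ} (h : DensLE α ι δ) : DensLE α (κ ⊕ ι) δ := fun A hA => by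
  rw [avg_sum_arrow]
  exact avg_le_of_le fun u => h _ (hA.fiber u)

theorem DensLE.congr {δ : ℝ} (h : DensLE α ι δ) (e : ι ≃ κ) : DensLE α κ δ := fun A hA => by
  have := h {x | x ∘ e.symm ∈ A} fun l => by
    obtain ⟨a, ha⟩ := hA ⟨l.idxFun ∘ e.symm, by
      obtain ⟨i, hi⟩ := l.proper
      exact ⟨e i, by simp [hi]⟩⟩
    exact ⟨a, ha⟩
  exact (avg_arrow_congr e.symm (ind A)).symm.trans_le this

/-- A finite type of cardinality at least `n` splits off a copy of `Fin n`. -/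
theorem exists_equiv_sum_fin {n m : ℕ} (h : n + m ≤ Nat.card ι) :
    ∃ κ : Type, Finite κ ∧ m ≤ Nat.card κ ∧ Nonempty (κ ⊕ Fin n ≃ ι) := by
  obtain ⟨r, hr⟩ := Nat.exists_eq_add_of_le h
  refine ⟨Fin (m + r), inferInstance, by simp, ⟨?_⟩⟩
  exact finSumFinEquiv.trans ((finCongr (by omega)).trans (Finite.equivFin ι).symm)

theorem DensLE.of_le_card [Nonempty α] {n : ℕ} {δ : ℝ} (h : DensLE α (Fin n) δ)
    (hn : n ≤ Nat.card ι) : DensLE α ι δ := by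
  obtain ⟨κ, _, -, ⟨e⟩⟩ := exists_equiv_sum_fin (ι := ι) (n := n) (m := 0) hn
  exact h.sum.congr e

/-- The multidimensional form of the density Hales-Jewett property. -/
theorem DHJ.exists_subspace_fin [Nonempty α] (h : DHJ α) (d : ℕ) : ∀ δ : ℝ, 0 < δ →
    ∃ n : ℕ, ∀ (ι : Type) [Finite ι], n ≤ Nat.card ι → ∀ A : Set (ι → α), δ ≤ avg (ind A) →
      ∃ V : Subspace (Fin d) α ι, ∀ x, V x ∈ A := by
  induction d with
  | zero =>
    intro δ hδ
    refine ⟨0, fun ι _ _ A hA => ?_⟩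
    obtain ⟨x, hx⟩ := exists_avg_le (ind A)
    have hxA : x ∈ A := by
      by_contra hxA
      rw [ind_of_notMem hxA] at hx
      linarith
    exact ⟨⟨fun i => Sum.inl (x i), fun e => e.elim0⟩, fun _ => hxA⟩
  | succ d ih =>
    intro δ hδ
    obtain ⟨n, hn⟩ := h (δ / 2) (by positivity)
    set t : ℝ := (Nat.card (Line α (Fin (n + 1))) : ℝ)
    have ht : 0 < t := Nat.cast_pos.2 Nat.card_pos
    obtain ⟨m, hm⟩ := ih (δ / 2 / t) (by positivity)
    refine ⟨n + 1 + m, fun ι _ hι A hA => ?_⟩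
    obtain ⟨κ, _, hκ, ⟨e⟩⟩ := exists_equiv_sum_fin (ι := ι) (n := n + 1) (m := m) hι
    replace hn : DensLE α (Fin (n + 1)) (δ / 2) := hn.of_le_card (by simp)
    rw [← avg_arrow_congr e.symm, avg_sum_arrow] at hA
    obtain ⟨l, hl⟩ := exists_popular (ε := δ / 2) (T := Line α (Fin (n + 1)))
      (f := fun y : κ → α => avg fun x => ind A (Sum.elim y x ∘ e.symm))
      (fun y => avg_le_of_le fun x => ind_le_one _ _) (by positivity)
      (fun l => {y | ∀ a, Sum.elim y (l a) ∘ e.symm ∈ A}) fun y hy => by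
        by_contra! hl
        exact hy.not_ge (hn {x | Sum.elim y x ∘ e.symm ∈ A} fun l => by simpa using hl l)
    obtain ⟨V, hV⟩ := hm κ hκ {y | ∀ a, Sum.elim y (l a) ∘ e.symm ∈ A} (by
      rw [div_le_iff₀' ht]
      linarith)
    refine ⟨(V.prodLine l).reindex (Equiv.refl _) (Equiv.refl _) e, fun x => ?_⟩
    convert hV (x ∘ Fin.succ) (x 0) using 1
    ext i
    simp [Subspace.prodLine_apply]

theorem DHJ.exists_subspace [Nonempty α] (h : DHJ α) (η : Type) [Finite η] {δ : ℝ} (hδ : 0 < δ) :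
    ∃ n : ℕ, ∀ (ι : Type) [Finite ι], n ≤ Nat.card ι → ∀ A : Set (ι → α), δ ≤ avg (ind A) →
      ∃ V : Subspace η α ι, ∀ x, V x ∈ A := by
  obtain ⟨n, hn⟩ := h.exists_subspace_fin (Nat.card η) δ hδ
  refine ⟨n, fun ι _ hι A hA => ?_⟩
  obtain ⟨V, hV⟩ := hn ι hι A hA
  refine ⟨V.reindex (Finite.equivFin η).symm (Equiv.refl _) (Equiv.refl _), fun x => ?_⟩
  convert hV (x ∘ (Finite.equivFin η).symm) using 1
  ext i
  simp

/-! ### Dense insensitive sets -/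

theorem avg_mask [Nonempty α] (f : (ι → Option α) → ℝ) :
    avg f = avg fun b => avg fun w => f (mask b w) := by
  refine avg_resample (fun p => (mask p.1 p.2, fun i => (p.1 i).getD (p.2 i))) (fun p => ?_) f
  refine Prod.ext (funext fun i => ?_) (funext fun i => ?_) <;>
  cases h : p.1 i <;> simp [mask, h]

/-- A word over `Option α` typically has many letters different from `none`. -/
theorem avg_few_some [Nonempty α] (n : ℕ) {ε : ℝ} (hε : 0 < ε) : ∃ m : ℕ,
    avg (ind {b : Fin m → Option α | Nat.card {i // b i ≠ none} < n}) ≤ ε := by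
  classical
  have := Fintype.ofFinite α
  set g : Option α → ℝ := fun o => o.elim 1 fun _ => 1 / 2 with hg
  have hg0 : 0 ≤ avg g := avg_nonneg fun o => by cases o <;> simp [hg]
  have hg1 : avg g < 1 := by
    rw [avg_eq_sum, div_lt_one (by positivity), Fintype.sum_option, Fintype.card_option]
    have : (0 : ℝ) < Fintype.card α := by exact_mod_cast Fintype.card_pos
    simp [hg]
    linarith
  obtain ⟨m, hm⟩ := exists_pow_lt_of_lt_one (show 0 < ε / 2 ^ n by positivity) hg1
  refine ⟨m, ?_⟩
  calc _ ≤ avg fun b : Fin m → Option α => 2 ^ n * ∏ i, g (b i) := by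
        refine avg_mono fun b => ?_
        have hprod : ∏ i, g (b i) = (1 / 2) ^ Nat.card {i // b i ≠ none} := by
          rw [Nat.card_eq_fintype_card, Fintype.card_subtype, ← Finset.prod_const,
            Finset.prod_filter]
          refine Finset.prod_congr rfl fun i _ => ?_
          cases h : b i <;> simp [hg]
        rw [hprod]
        by_cases hb : b ∈ {b : Fin m → Option α | Nat.card {i // b i ≠ none} < n}
        · rw [ind_of_mem hb]
          calc (1 : ℝ) = 2 ^ n * (1 / 2) ^ n := by rw [← mul_pow]; norm_num
            _ ≤ _ := by
              gcongr 2 ^ n * ?_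
              exact pow_le_pow_of_le_one (by norm_num) (by norm_num) (le_of_lt hb)
        · rw [ind_of_notMem hb]
          positivity
    _ = 2 ^ n * avg g ^ m := by rw [avg_const_mul, avg_pi_prod, Fintype.card_fin]
    _ ≤ ε := by
      rw [lt_div_iff₀' (by positivity)] at hm
      exact hm.le

/-- Dense insensitive sets of words contain subspaces. -/
theorem DHJ.exists_subspace_collapse [Nonempty α] (h : DHJ α) (η : Type) [Finite η] {ε : ℝ}
    (hε : 0 < ε) : ∃ m : ℕ, ∀ (a : α) (E : Set (Fin m → α)),
      ε < avg (fun x : Fin m → Option α => ind E (collapse a x)) →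
        ∃ V : Subspace η (Option α) (Fin m), ∀ x, collapse a (V x) ∈ E := by
  classical
  obtain ⟨n, hn⟩ := h.exists_subspace η (half_pos hε)
  obtain ⟨m, hm⟩ := avg_few_some (α := α) n (half_pos hε)
  refine ⟨m, fun a E hE => ?_⟩
  rw [avg_mask] at hE
  set B := {b : Fin m → Option α | Nat.card {i // b i ≠ none} < n}
  obtain ⟨b, hb⟩ := exists_avg_le fun b : Fin m → Option α =>
    (avg fun w => ind E (collapse a (mask b w))) - ind B b
  rw [avg_sub] at hb
  have hbB : b ∉ B := fun hbB => by
    rw [ind_of_mem hbB] at hb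
    have : avg (fun w => ind E (collapse a (mask b w))) ≤ 1 :=
      avg_le_of_le fun x => ind_le_one _ _
    linarith
  rw [ind_of_notMem hbB] at hb
  let glue : ({i // b i ≠ none} → α) → Fin m → α :=
    fun u i => if hi : b i ≠ none then u ⟨i, hi⟩ else a
  have hglue : avg (fun w => ind E (collapse a (mask b w))) = avg (ind {u | glue u ∈ E}) := by
    rw [← avg_arrow_congr (Equiv.sumCompl fun i => b i ≠ none).symm, avg_sum_arrow]
    congr 1
    ext u
    refine Eq.trans (congrArg avg (funext fun v => ?_)) (avg_const _)
    refine congrArg (ind E) (funext fun i => ?_)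
    by_cases hi : b i ≠ none
    · obtain ⟨c, hc⟩ := Option.ne_none_iff_exists'.1 hi
      simp [collapse, mask, glue, hc,
        Equiv.sumCompl_symm_apply_of_pos (p := fun i => b i ≠ none) hi]
    · simp [collapse, mask, glue, not_not.1 hi]
  obtain ⟨V, hV⟩ := hn {i // b i ≠ none} (not_lt.1 hbB) {u | glue u ∈ E} (by linarith)
  refine ⟨⟨fun i => if hi : b i ≠ none then (V.idxFun ⟨i, hi⟩).map some id else Sum.inl none,
    fun e => ?_⟩, fun x => ?_⟩
  · obtain ⟨⟨i, hi⟩, hVi⟩ := V.proper e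
    exact ⟨i, by rw [dif_pos hi, hVi]; rfl⟩
  · refine (congrArg (· ∈ E) (funext fun i => ?_)).mpr (hV (collapse a x))
    by_cases hi : b i ≠ none
    · cases hVi : V.idxFun ⟨i, hi⟩ <;> simp [collapse, glue, Subspace.coe_apply, hi, hVi]
    · simp [collapse, glue, Subspace.coe_apply, not_not.1 hi]

end Subspaces

/-! ### Covering insensitive sets by subspaces -/

section Covering

open Combinatorics

variable {α : Type} [Finite α] [Nonempty α]

/-- Iterated removal of subspaces from an insensitive set: the uncovered part of the set shrinks
geometrically. -/
theorem exists_iterated_cover {η κ : Type} [Finite η] [Finite κ] {ε : ℝ} (hε : 0 ≤ ε)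
    [Nonempty (Subspace η (Option α) κ)]
    (hκ : ∀ (a : α) (E : Set (κ → α)), ε < avg (fun x : κ → Option α => ind E (collapse a x)) →
      ∃ V : Subspace η (Option α) κ, ∀ x, collapse a (V x) ∈ E) :
    ∃ θ : ℝ, 0 < θ ∧ θ ≤ 1 ∧ ∀ N : ℕ, ∃ (ι : Type) (_ : Finite ι), ∀ f : (ι → Option α) → ℝ,
      (∀ x, f x ≤ 1) → (∀ V : Subspace η (Option α) ι, avg (fun x => f (V x)) ≤ 0) →
      ∀ (a : α) (E : Set (ι → α)), avg (fun x => ind E (collapse a x) * f x) ≤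
        ε + (1 - θ) ^ N * (avg (fun x => ind E (collapse a x)) - ε) := by
  have hT : (1 : ℝ) ≤ Nat.card (Subspace η (Option α) κ) := Nat.one_le_cast.2 Nat.card_pos
  have hK : (1 : ℝ) ≤ Nat.card (κ → Option α) := Nat.one_le_cast.2 Nat.card_pos
  set T : ℝ := (Nat.card (Subspace η (Option α) κ) : ℝ)
  set K : ℝ := (Nat.card (κ → Option α) : ℝ)
  have hTK : 1 ≤ T * K := one_le_mul_of_one_le_of_one_le hT hK
  refine ⟨1 / (T * K), by positivity, (div_le_one (by positivity)).2 hTK, fun N => ?_⟩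
  set θ : ℝ := 1 / (T * K) with hθ
  have hθ0 : 0 < θ := by positivity
  have hθ1 : θ ≤ 1 := (div_le_one (by positivity)).2 hTK
  induction N with
  | zero =>
    refine ⟨Empty, inferInstance, fun f hf _ a E => ?_⟩
    rw [pow_zero, one_mul, add_sub_cancel]
    refine avg_mono fun x => ?_
    exact mul_le_of_le_one_right (ind_nonneg _ _) (hf x)
  | succ N ih =>
    obtain ⟨ι, _, hι⟩ := ih
    refine ⟨κ ⊕ ι, inferInstance, fun f hf hV a E => ?_⟩
    obtain ⟨V, hVP⟩ := exists_popular (ε := ε) (T := Subspace η (Option α) κ)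
      (f := fun y : ι → Option α => avg fun x => ind E (collapse a (Sum.elim x y)))
      (fun y => avg_le_of_le fun x => ind_le_one _ _) hε
      (fun V => {y | ∀ u, collapse a (Sum.elim (V u) y) ∈ E}) fun y hy => by
        obtain ⟨V, hV⟩ := hκ a {w | Sum.elim w (collapse a y) ∈ E} (by
          simp only [collapse_elim] at hy
          exact hy)
        exact ⟨V, fun u => by rw [collapse_elim]; exact hV u⟩
    set P : Set (ι → Option α) := {y | ∀ u, collapse a (Sum.elim (V u) y) ∈ E} with hP
    rw [avg_comm] at hVP
    let E' : (κ → Option α) → Set (ι → α) := fun x =>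
      {w | Sum.elim (collapse a x) w ∈ E ∧
        ¬ (x ∈ Set.range V ∧ ∀ u, Sum.elim (collapse a (V u)) w ∈ E)}
    have hsplit : ∀ x y, ind E (collapse a (Sum.elim x y)) =
        ind (E' x) (collapse a y) + ind (Set.range V) x * ind P y := by
      intro x y
      have hyP : (y ∈ P) ↔ ∀ u, Sum.elim (collapse a (V u)) (collapse a y) ∈ E := by
        simp only [hP, ← collapse_elim]; rfl
      rw [collapse_elim]
      by_cases hx : x ∈ Set.range V
      · rw [ind_of_mem hx]
        by_cases hy : y ∈ P
        · rw [ind_of_mem hy, ind_of_notMem (A := E' x) fun h => h.2 ⟨hx, hyP.1 hy⟩, ind_of_mem]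
          · norm_num
          · obtain ⟨u, rfl⟩ := hx
            exact hyP.1 hy u
        · rw [ind_of_notMem hy, mul_zero, add_zero]
          by_cases hE : Sum.elim (collapse a x) (collapse a y) ∈ E
          · rw [ind_of_mem hE, ind_of_mem (A := E' x) ⟨hE, fun h => hy (hyP.2 h.2)⟩]
          · rw [ind_of_notMem hE, ind_of_notMem (A := E' x) fun h => hE h.1]
      · rw [ind_of_notMem hx, zero_mul, add_zero]
        by_cases hE : Sum.elim (collapse a x) (collapse a y) ∈ E
        · rw [ind_of_mem hE, ind_of_mem (A := E' x) ⟨hE, fun h => hx h.1⟩]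
        · rw [ind_of_notMem hE, ind_of_notMem (A := E' x) fun h => hE h.1]
    have hdens : (avg fun x => avg fun y => ind E (collapse a (Sum.elim x y))) =
        (avg fun x => avg fun y => ind (E' x) (collapse a y)) +
          avg (ind (Set.range V)) * avg (ind P) := by
      simp only [hsplit, avg_add, avg_const_mul]
      congr 1
      rw [mul_comm, ← avg_const_mul]
      simp only [mul_comm]
    have hremoved : (avg fun x => avg fun y =>
        ind (Set.range V) x * ind P y * f (Sum.elim x y)) ≤ 0 := by
      rw [avg_comm]
      refine avg_le_of_le fun y => ?_
      simp only [mul_assoc]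
      refine avg_range (f := fun x => ind P y * f (Sum.elim x y)) V.apply_injective ?_
      rw [avg_const_mul]
      refine mul_nonpos_of_nonneg_of_nonpos (ind_nonneg _ _) ?_
      simpa only [Subspace.horizontal_apply] using hV (V.horizontal y)
    have hrest : (avg fun x => avg fun y => ind (E' x) (collapse a y) * f (Sum.elim x y)) ≤
        ε + (1 - θ) ^ N * ((avg fun x => avg fun y => ind (E' x) (collapse a y)) - ε) := by
      refine (avg_mono fun x => hι (fun y => f (Sum.elim x y)) (fun y => hf _) (fun W => ?_) a
        (E' x)).trans_eq ?_
      · simpa only [Subspace.vertical_apply] using hV (W.vertical x)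
      · rw [avg_add, avg_const, avg_const_mul, avg_sub, avg_const]
    have hrange : 1 / K ≤ avg (ind (Set.range V)) := by
      have u : η → Option α := fun _ => none
      have := le_card_mul_avg (ind_nonneg (Set.range V)) (V u)
      rw [ind_of_mem (Set.mem_range_self u)] at this
      rwa [div_le_iff₀' (by positivity)]
    rw [avg_sum_arrow, avg_sum_arrow]
    have hP0 : 0 ≤ avg (ind P) := avg_nonneg (ind_nonneg P)
    have hprod : θ * ((avg fun x => avg fun y => ind E (collapse a (Sum.elim x y))) - ε) ≤
        avg (ind (Set.range V)) * avg (ind P) := by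
      calc _ ≤ θ * (T * avg (ind P)) := by gcongr; linarith
        _ = 1 / K * avg (ind P) := by rw [hθ]; field_simp
        _ ≤ _ := by gcongr
    calc _ = (avg fun x => avg fun y => ind (E' x) (collapse a y) * f (Sum.elim x y)) +
          avg fun x => avg fun y => ind (Set.range V) x * ind P y * f (Sum.elim x y) := by
            simp only [hsplit, add_mul, avg_add]
      _ ≤ ε + (1 - θ) ^ N * ((avg fun x => avg fun y => ind (E' x) (collapse a y)) - ε) := by
            linarith
      _ ≤ _ := by
        rw [pow_succ, mul_assoc]
        have : 0 ≤ 1 - θ := by linarith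
        gcongr
        linarith

/-- A function bounded by `1` with nonpositive average on all subspaces of dimension `η` has almost
nonpositive integral on insensitive sets. -/
theorem DHJ.exists_cover_collapse (h : DHJ α) (η : Type) [Finite η] {ε : ℝ} (hε : 0 < ε) :
    ∃ (ι : Type) (_ : Finite ι), ∀ f : (ι → Option α) → ℝ,
      (∀ x, f x ≤ 1) → (∀ V : Subspace η (Option α) ι, avg (fun x => f (V x)) ≤ 0) →
      ∀ (a : α) (E : Set (ι → α)), avg (fun x => ind E (collapse a x) * f x) ≤ ε := by
  wlog hε1 : ε ≤ 1 generalizing ε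
  · obtain ⟨ι, hι, H⟩ := this one_pos le_rfl
    exact ⟨ι, hι, fun f h1 h2 a E => (H f h1 h2 a E).trans (not_le.1 hε1).le⟩
  obtain ⟨m, hm⟩ := h.exists_subspace_collapse η (half_pos hε)
  have : Nonempty (Subspace η (Option α) (Fin m)) := by
    obtain ⟨a⟩ := ‹Nonempty α›
    obtain ⟨V, -⟩ := hm a Set.univ (by simp [ind, avg_const]; linarith)
    exact ⟨V⟩
  obtain ⟨θ, hθ0, hθ1, H⟩ := exists_iterated_cover (half_pos hε).le hm
  obtain ⟨N, hN⟩ := exists_pow_lt_of_lt_one (half_pos hε) (show 1 - θ < 1 by linarith)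
  obtain ⟨ι, hι, H⟩ := H N
  refine ⟨ι, hι, fun f h1 h2 a E => (H f h1 h2 a E).trans ?_⟩
  have h0 : 0 ≤ (1 - θ) ^ N := pow_nonneg (by linarith) _
  have h1 : (avg fun x => ind E (collapse a x)) ≤ 1 := avg_le_of_le fun x => ind_le_one _ _
  nlinarith

theorem DHJ.exists_cover_inter (h : DHJ α) (s : Finset α) : ∀ (η : Type) [Finite η] (ε : ℝ),
    0 < ε → ∃ (ι : Type) (_ : Finite ι), ∀ f : (ι → Option α) → ℝ,
      (∀ x, f x ≤ 1) → (∀ V : Subspace η (Option α) ι, avg (fun x => f (V x)) ≤ 0) →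
      ∀ E : α → Set (ι → α), avg (fun x => (∏ a ∈ s, ind (E a) (collapse a x)) * f x) ≤ ε := by
  classical
  induction s using Finset.induction_on with
  | empty =>
    intro η _ ε hε
    refine ⟨η, inferInstance, fun f _ hf E => ?_⟩
    simp only [Finset.prod_empty, one_mul]
    exact (hf default).trans hε.le
  | insert a s has ih =>
    intro η _ ε hε
    obtain ⟨η', _, hη'⟩ := ih η (ε / 2) (half_pos hε)
    obtain ⟨ι, hι, H⟩ := h.exists_cover_collapse η' (half_pos hε)
    refine ⟨ι, hι, fun f h1 h2 E => ?_⟩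
    have key := H (fun x => (∏ b ∈ s, ind (E b) (collapse b x)) * f x - ε / 2) (fun x => ?_)
      (fun V => ?_) a (E a)
    · have hE : (avg fun x => ind (E a) (collapse a x)) ≤ 1 := avg_le_of_le fun x => ind_le_one _ _
      have heq : (avg fun x => (∏ b ∈ insert a s, ind (E b) (collapse b x)) * f x) =
          (avg fun x => ind (E a) (collapse a x) *
            ((∏ b ∈ s, ind (E b) (collapse b x)) * f x - ε / 2)) +
          ε / 2 * avg fun x => ind (E a) (collapse a x) := by
        rw [← avg_const_mul, ← avg_add]
        congr 1
        ext x
        rw [Finset.prod_insert has]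
        ring
      rw [heq]
      nlinarith
    · have h0 : 0 ≤ ∏ b ∈ s, ind (E b) (collapse b x) :=
        Finset.prod_nonneg fun b _ => ind_nonneg _ _
      have h1' : ∏ b ∈ s, ind (E b) (collapse b x) ≤ 1 :=
        Finset.prod_le_one (fun b _ => ind_nonneg _ _) fun b _ => ind_le_one _ _
      nlinarith [h1 x]
    · rw [avg_sub, avg_const, sub_nonpos]
      have hV : ∀ b x, collapse b (V (some ∘ collapse b x)) = collapse b (V x) := by
        intro b x
        ext i
        cases hi : V.idxFun i <;> simp [collapse, Subspace.coe_apply, hi]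
      have := hη' (fun x => f (V x)) (fun x => h1 _)
        (fun W => by simpa only [Subspace.comp_apply] using h2 (V.comp W))
        fun b => {w | collapse b (V (some ∘ w)) ∈ E b}
      refine Eq.trans_le (congrArg avg (funext fun x => ?_)) this
      congr 1
      refine Finset.prod_congr rfl fun b _ => ?_
      rw [← hV]
      rfl

/-- A function bounded by `1` with nonpositive average on all subspaces of dimension `η` has almost
nonpositive integral on the complement of an intersection of insensitive sets. -/
theorem DHJ.exists_cover_compl [Fintype α] (h : DHJ α) (η : Type) [Finite η] {ε : ℝ} (hε : 0 < ε) :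
    ∃ (ι : Type) (_ : Finite ι), ∀ f : (ι → Option α) → ℝ,
      (∀ x, f x ≤ 1) → (∀ V : Subspace η (Option α) ι, avg (fun x => f (V x)) ≤ 0) →
      ∀ E : α → Set (ι → α), avg (fun x => (1 - ∏ a, ind (E a) (collapse a x)) * f x) ≤ ε := by
  classical
  have hk : (0 : ℝ) < Fintype.card α := Nat.cast_pos.2 Fintype.card_pos
  obtain ⟨ι, hι, H⟩ := h.exists_cover_inter Finset.univ η (ε / Fintype.card α) (by positivity)
  refine ⟨ι, hι, fun f h1 h2 E => ?_⟩
  have key : ∀ s : Finset α, avg (fun x => (1 - ∏ a ∈ s, ind (E a) (collapse a x)) * f x) ≤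
      #s * (ε / Fintype.card α) := by
    intro s
    induction s using Finset.induction_on with
    | empty => simp [avg_const]
    | insert a s has ih =>
      have hstep := H f h1 h2 fun b => if b ∈ s then E b else if b = a then (E a)ᶜ else Set.univ
      have hprod : ∀ x, (∏ b, ind (if b ∈ s then E b else if b = a then (E a)ᶜ else Set.univ)
          (collapse b x)) = (∏ b ∈ s, ind (E b) (collapse b x)) *
            (1 - ind (E a) (collapse a x)) := by
        intro x
        rw [← Finset.prod_subset (Finset.subset_univ (insert a s)), Finset.prod_insert has,
          if_neg has, if_pos rfl, ind_compl, mul_comm]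
        · congr 1
          exact Finset.prod_congr rfl fun b hb => by rw [if_pos hb]
        · intro b _ hb
          rw [Finset.mem_insert, not_or] at hb
          rw [if_neg hb.2, if_neg hb.1, ind_of_mem (Set.mem_univ _)]
      simp only [hprod] at hstep
      rw [Finset.card_insert_of_notMem has, Nat.cast_succ, add_mul, one_mul]
      refine le_trans (Eq.le ?_) (add_le_add ih hstep)
      rw [← avg_add]
      congr 1
      ext x
      rw [Finset.prod_insert has]
      ring
  refine (key Finset.univ).trans_eq ?_
  rw [Finset.card_univ]
  field_simp

end Covering

/-! ### Adding a letter to the alphabet -/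

section AddLetter

open Combinatorics

variable {α μ κ ν η : Type}

/-- An active coordinate of a line. -/
noncomputable def Combinatorics.Line.pivot (l : Line α μ) : μ := l.proper.choose

theorem Combinatorics.Line.idxFun_pivot (l : Line α μ) : l.idxFun l.pivot = none :=
  l.proper.choose_spec

/-- Extend a word `x` by blocks indexed by lines; in the block of a line, the letter `none` is
replaced by the letter of `x` at the pivot of the line. -/
noncomputable def fill (z : Line α μ × κ → Option α) (x : μ → α) : μ ⊕ Line α μ × κ → α :=
  Sum.elim x fun q => (z q).getD (x q.1.pivot)

/-- The line over `Option α` whose points at the letters of `α` are the extensions of the points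
of `l`. -/
noncomputable def fillLine (z : Line α μ × κ → Option α) (l : Line α μ) :
    Line (Option α) (μ ⊕ Line α μ × κ) where
  idxFun := Sum.elim (fun i => (l.idxFun i).map some)
    fun q => (z q).elim ((l.idxFun q.1.pivot).map some) (some ∘ some)
  proper := ⟨Sum.inl l.pivot, by simp [l.idxFun_pivot]⟩

theorem fillLine_some (z : Line α μ × κ → Option α) (l : Line α μ) (a : α) :
    fillLine z l (some a) = some ∘ fill z (l a) := by
  ext1 i
  rcases i with i | q
  · cases h : l.idxFun i <;> simp [fillLine, fill, Line.coe_apply, h]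
  · cases h : z q
    · cases h' : l.idxFun q.1.pivot <;> simp [fillLine, fill, Line.coe_apply, h, h']
    · simp [fillLine, fill, Line.coe_apply, h]

open Classical in
/-- Replace the block of a line. -/
noncomputable def setBlock (l : Line α μ) (z : Line α μ × κ → Option α) (u : κ → Option α) :
    Line α μ × κ → Option α := fun q => if q.1 = l then u q.2 else z q

theorem setBlock_setBlock (l : Line α μ) (z : Line α μ × κ → Option α) (u : κ → Option α) :
    setBlock l (setBlock l z u) (fun s => z (l, s)) = z := by
  ext1 ⟨l', s⟩
  by_cases h : l' = l
  · simp [setBlock, h]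
  · simp [setBlock, h]

theorem avg_setBlock [Finite α] [Finite μ] [Finite κ] (l : Line α μ)
    (f : (Line α μ × κ → Option α) → ℝ) :
    avg f = avg fun z => avg fun u => f (setBlock l z u) :=
  avg_resample (fun p => (setBlock l p.1 p.2, fun s => p.1 (l, s)))
    (fun p => Prod.ext (setBlock_setBlock _ _ _) (by simp [setBlock])) f

open Classical in
/-- The subspace spanned by the points at the letter `none` when the block of `l` varies. -/
noncomputable def blockSubspace (z : Line α μ × κ → Option α) (l : Line α μ) :
    Subspace κ (Option α) (μ ⊕ Line α μ × κ) where
  idxFun := Sum.elim (fun i => Sum.inl (fillLine z l none (Sum.inl i)))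
    fun q => if q.1 = l then Sum.inr q.2 else Sum.inl (fillLine z l none (Sum.inr q))
  proper s := ⟨Sum.inr (l, s), by simp⟩

theorem blockSubspace_apply (z : Line α μ × κ → Option α) (l : Line α μ) (u : κ → Option α) :
    blockSubspace z l u = fillLine (setBlock l z u) l none := by
  ext1 i
  rcases i with i | ⟨l', s⟩
  · rfl
  · by_cases h : l' = l
    · subst h
      cases hu : u s <;>
        simp [blockSubspace, fillLine, setBlock, Subspace.coe_apply, Line.coe_apply, hu,
          Line.idxFun_pivot]
    · simp [blockSubspace, fillLine, setBlock, Subspace.coe_apply, Line.coe_apply, h]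

theorem fill_setBlock_collapse (z : Line α μ × κ → Option α) (l : Line α μ) (u : κ → Option α)
    (a : α) : fill (setBlock l z (some ∘ collapse a u)) (l a) = fill (setBlock l z u) (l a) := by
  ext1 i
  rcases i with i | ⟨l', s⟩
  · rfl
  · by_cases h : l' = l
    · subst h
      simp [fill, setBlock, collapse, l'.idxFun_pivot, Line.coe_apply]
    · simp [fill, setBlock, h]

variable [Fintype α] [Nonempty α] [Finite μ] [Finite κ] [Finite η]

/-- Points completing a line to a larger alphabet are rare where the line is contained in a
line-free set. -/
theorem LineFree.avg_fillLine_none_le {A : Set ((μ ⊕ Line α μ × κ) ⊕ ν → Option α)}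
    (hA : LineFree A) (l : Line α μ) {c ε : ℝ} (hc0 : 0 ≤ c) (hc : DensLE (Option α) η c)
    (hκ : ∀ f : (κ → Option α) → ℝ, (∀ x, f x ≤ 1) →
      (∀ V : Subspace η (Option α) κ, avg (fun x => f (V x)) ≤ 0) →
      ∀ E : α → Set (κ → α), avg (fun x => (1 - ∏ a, ind (E a) (collapse a x)) * f x) ≤ ε)
    (y : ν → Option α) :
    avg (fun z => ind A (Sum.elim (fillLine z l none) y)) ≤
      c + ε - c * avg (ind {z | ∀ a, Sum.elim (some ∘ fill z (l a)) y ∈ A}) := by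
  set P : Set (Line α μ × κ → Option α) := {z | ∀ a, Sum.elim (some ∘ fill z (l a)) y ∈ A} with hP
  rw [avg_setBlock l, avg_setBlock l (ind P), ← avg_const_mul,
    ← avg_const (X := Line α μ × κ → Option α) (c + ε), ← avg_sub]
  refine avg_mono fun z => ?_
  have key := hκ (fun u => ind A (Sum.elim (fillLine (setBlock l z u) l none) y) - c)
    (fun u => by linarith [ind_le_one A (Sum.elim (fillLine (setBlock l z u) l none) y)])
    (fun V => by
      rw [avg_sub, avg_const, sub_nonpos]
      refine Eq.trans_le (congrArg avg (funext fun x => ?_))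
        (hc _ (hA.subspace (((blockSubspace z l).horizontal y).comp V)))
      rw [← blockSubspace_apply, ← Subspace.horizontal_apply, ← Subspace.comp_apply]
      rfl)
    fun a => {w | Sum.elim (some ∘ fill (setBlock l z (some ∘ w)) (l a)) y ∈ A}
  have hprod : ∀ u : κ → Option α, (∏ a, ind {w | Sum.elim (some ∘ fill (setBlock l z (some ∘ w))
      (l a)) y ∈ A} (collapse a u)) = ind P (setBlock l z u) := by
    intro u
    by_cases hu : setBlock l z u ∈ P
    · rw [ind_of_mem hu]
      refine Finset.prod_eq_one fun a _ => ind_of_mem ?_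
      rw [Set.mem_ofPred_eq, fill_setBlock_collapse]
      exact hu a
    · rw [ind_of_notMem hu]
      rw [hP, Set.mem_ofPred_eq, not_forall] at hu
      obtain ⟨a, ha⟩ := hu
      refine Finset.prod_eq_zero (Finset.mem_univ a) (ind_of_notMem ?_)
      rwa [Set.mem_ofPred_eq, fill_setBlock_collapse]
  have hdisj : ∀ u : κ → Option α, ind P (setBlock l z u) *
      ind A (Sum.elim (fillLine (setBlock l z u) l none) y) = 0 := by
    intro u
    by_cases hu : setBlock l z u ∈ P
    · rw [ind_of_notMem (A := A), mul_zero]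
      intro hn
      obtain ⟨b, hb⟩ := hA ((fillLine (setBlock l z u) l).horizontal y)
      rw [Line.horizontal_apply] at hb
      cases b with
      | none => exact hb hn
      | some a =>
        rw [fillLine_some] at hb
        exact hb (hu a)
    · rw [ind_of_notMem hu, zero_mul]
  rw [show (fun u : κ → Option α => (1 - ∏ a, ind {w | Sum.elim (some ∘ fill (setBlock l z
      (some ∘ w)) (l a)) y ∈ A} (collapse a u)) *
      (ind A (Sum.elim (fillLine (setBlock l z u) l none) y) - c)) = fun u =>
        (ind A (Sum.elim (fillLine (setBlock l z u) l none) y) - c) + c * ind P (setBlock l z u)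
      from funext fun u => by rw [hprod]; linear_combination -hdisj u,
    avg_add, avg_sub, avg_const, avg_const_mul] at key
  linarith

/-- The density increment: if `Option α` has density Hales-Jewett bounds arbitrarily close to `L`,
then it has a strictly smaller bound. -/
theorem DHJ.exists_lt (h : DHJ α) {L : ℝ} (hL : 0 < L) (hL1 : L ≤ 1)
    (hS : ∀ δ, L < δ → ∃ n : ℕ, DensLE (Option α) (Fin n) δ) :
    ∃ δ < L, ∃ n : ℕ, DensLE (Option α) (Fin n) δ := by
  obtain ⟨m, hm⟩ := h (L / 4) (by positivity)
  replace hm : DensLE α (Fin (m + 1)) (L / 4) := hm.of_le_card (by simp)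
  have ht : (1 : ℝ) ≤ Nat.card (Line α (Fin (m + 1))) := Nat.one_le_cast.2 Nat.card_pos
  set t : ℝ := (Nat.card (Line α (Fin (m + 1))) : ℝ)
  set γ : ℝ := L / 4 * (L / (4 * t)) with hγ
  have hγ0 : 0 < γ := by positivity
  obtain ⟨n₁, hn₁⟩ := hS (L + γ) (by linarith)
  obtain ⟨κ, _, hκ⟩ := h.exists_cover_compl (Fin n₁) hγ0
  set I := Fin (m + 1) ⊕ Line α (Fin (m + 1)) × κ
  have hK : (1 : ℝ) ≤ Nat.card (I → Option α) := Nat.one_le_cast.2 Nat.card_pos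
  set K : ℝ := (Nat.card (I → Option α) : ℝ)
  set ε : ℝ := γ / (2 * K) with hε
  have hε0 : 0 < ε := by positivity
  obtain ⟨n₂, hn₂⟩ := hS (L + ε) (by linarith)
  by_contra! hcon
  have hI : ¬ DensLE (Option α) (I ⊕ Fin n₂) (L - ε) := fun hI =>
    hcon (L - ε) (by linarith) _ (hI.congr (Finite.equivFin _))
  simp only [DensLE, not_forall, not_le] at hI
  obtain ⟨A, hA, hAL⟩ := hI
  rw [avg_sum_arrow] at hAL
  have hrow : ∀ x : I → Option α, L - γ ≤ avg fun y => ind A (Sum.elim x y) := by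
    intro x
    have h1 := le_card_mul_avg (f := fun x => (L + ε) - avg fun y => ind A (Sum.elim x y))
      (fun x => sub_nonneg.2 (hn₂ _ (hA.fiber x))) x
    rw [avg_sub, avg_const] at h1
    have h2 : K * (L + ε - avg fun u => avg fun v => ind A (Sum.elim u v)) ≤ K * (2 * ε) := by
      gcongr
      linarith
    have h3 : K * (2 * ε) = γ := by rw [hε]; field_simp
    linarith
  obtain ⟨l, hl⟩ := exists_popular (ε := L / 4) (T := Line α (Fin (m + 1)))
    (Y := (Line α (Fin (m + 1)) × κ → Option α) × (Fin n₂ → Option α))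
    (f := fun p => avg fun x : Fin (m + 1) → α => ind A (Sum.elim (some ∘ fill p.1 x) p.2))
    (fun p => avg_le_of_le fun x => ind_le_one _ _) (by positivity)
    (fun l => {p | ∀ a, Sum.elim (some ∘ fill p.1 (l a)) p.2 ∈ A}) fun p hp => by
      by_contra! hl
      exact hp.not_ge (hm {x | Sum.elim (some ∘ fill p.1 x) p.2 ∈ A} fun l => by simpa using hl l)
  have hpop : L - γ ≤ avg fun p : (Line α (Fin (m + 1)) × κ → Option α) × (Fin n₂ → Option α) =>
      avg fun x : Fin (m + 1) → α => ind A (Sum.elim (some ∘ fill p.1 x) p.2) := by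
    rw [avg_prod]
    refine le_avg_of_le fun z => ?_
    rw [avg_comm]
    exact le_avg_of_le fun x => hrow (some ∘ fill z x)
  have hnone : L - γ ≤ avg fun y : Fin n₂ → Option α =>
      avg fun z => ind A (Sum.elim (fillLine z l none) y) := by
    rw [avg_comm]
    exact le_avg_of_le fun z => hrow _
  have hup := hnone.trans (avg_mono fun y =>
    hA.avg_fillLine_none_le l (by positivity) hn₁ hκ y)
  rw [avg_sub, avg_const, avg_const_mul] at hup
  replace hl := hpop.trans hl
  rw [avg_prod, avg_comm] at hl
  set p : ℝ := avg fun y : Fin n₂ → Option α =>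
    avg (ind {z | ∀ a, Sum.elim (some ∘ fill z (l a)) y ∈ A})
  replace hl : L - γ ≤ L / 4 + t * p := hl
  have hγL : γ ≤ L / 4 := by
    refine mul_le_of_le_one_right (by positivity) ((div_le_one (by positivity)).2 ?_)
    linarith
  have hp : L / (4 * t) ≤ p := by
    rw [div_le_iff₀ (by positivity)]
    linarith
  have h4 : 4 * γ ≤ L * p := by
    calc 4 * γ = L * (L / (4 * t)) := by rw [hγ]; ring
      _ ≤ _ := by gcongr
  have hp0 : 0 < p := lt_of_lt_of_le (by positivity) hp
  nlinarith [mul_pos hγ0 hp0]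

theorem densLE_of_one_le [Finite ν] {δ : ℝ} (hδ : 1 ≤ δ) : DensLE (Option α) ν δ :=
  fun A _ => avg_le_of_le fun x => (ind_le_one A x).trans hδ

/-- The density Hales-Jewett property is preserved by adding a letter to the alphabet. -/
theorem DHJ.option (h : DHJ α) : DHJ (Option α) := by
  set S : Set ℝ := {δ | ∃ n : ℕ, DensLE (Option α) (Fin n) δ} with hS
  have h1 : (1 : ℝ) ∈ S := ⟨0, densLE_of_one_le le_rfl⟩
  have h0 : ∀ δ ∈ S, 0 ≤ δ := fun δ ⟨n, hn⟩ =>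
    (avg_nonneg (ind_nonneg ∅)).trans (hn ∅ fun _ => ⟨none, id⟩)
  have hbdd : BddBelow S := ⟨0, h0⟩
  have hlt : ∀ δ, sInf S < δ → δ ∈ S := fun δ hδ => by
    obtain ⟨ε, ⟨n, hn⟩, hε⟩ := exists_lt_of_csInf_lt ⟨1, h1⟩ hδ
    exact ⟨n, hn.mono hε.le⟩
  intro δ hδ
  refine hlt δ (lt_of_le_of_lt ?_ hδ)
  by_contra! hL
  obtain ⟨ε, hε, hεS⟩ := h.exists_lt hL (csInf_le hbdd h1) hlt
  exact hε.not_ge (csInf_le hbdd hεS)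

/-- The density Hales-Jewett theorem. -/
theorem exists_dhj (k : ℕ) :
    ∃ α : Type, Finite α ∧ Nonempty α ∧ Nat.card α = k + 1 ∧ DHJ α := by
  induction k with
  | zero =>
    refine ⟨Unit, inferInstance, inferInstance, by simp, fun δ hδ => ⟨1, fun A hA => ?_⟩⟩
    refine avg_le_of_le fun x => ?_
    obtain ⟨a, ha⟩ := hA (Line.diagonal Unit (Fin 1))
    rw [ind_of_notMem fun hx =>
      ha ((Subsingleton.elim _ x : Line.diagonal Unit (Fin 1) a = x) ▸ hx)]
    exact hδ.le
  | succ k ih =>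
    obtain ⟨α, _, _, hα, h⟩ := ih
    have := Fintype.ofFinite α
    exact ⟨Option α, inferInstance, inferInstance, by rw [Finite.card_option, hα], h.option⟩

end AddLetter

/-! ### Szemerédi's theorem in cyclic groups -/

section Szemeredi

open Combinatorics

/-- Szemerédi's theorem in cyclic groups. -/
theorem exists_ap_zmod (k : ℕ) {δ : ℝ} (hδ : 0 < δ) : ∃ N₀ : ℕ, ∀ (N : ℕ) [NeZero N], N₀ ≤ N →
    ∀ B : Set (ZMod N), δ ≤ avg (ind B) →
      ∃ b d : ZMod N, d ≠ 0 ∧ ∀ j : ℕ, j ≤ k → b + j * d ∈ B := by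
  classical
  obtain ⟨α, _, _, hα, h⟩ := exists_dhj k
  obtain ⟨n, hn⟩ := h (δ / 2) (by positivity)
  let e : α ≃ Fin (k + 1) := (Finite.equivFin α).trans (finCongr hα)
  refine ⟨n + 1, fun N _ hN B hB => ?_⟩
  let σ : (Fin n → α) → ZMod N := fun x => ∑ i, ((e (x i) : ℕ) : ZMod N)
  obtain ⟨b, hb⟩ := exists_avg_le fun b => avg fun x => ind B (b + σ x)
  rw [avg_comm] at hb
  have hconst : ∀ x, avg (fun b => ind B (b + σ x)) = avg (ind B) := fun x =>
    avg_equiv (Equiv.addRight (σ x)) (ind B)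
  simp only [hconst, avg_const] at hb
  have hl : ∃ l : Line α (Fin n), ∀ a, b + σ (l a) ∈ B := by
    by_contra! hl
    have : (avg fun x => ind B (b + σ x)) ≤ δ / 2 := hn {x | b + σ x ∈ B} hl
    linarith
  obtain ⟨l, hl⟩ := hl
  set s : Finset (Fin n) := {i | l.idxFun i = none} with hs
  have hσ : ∀ a, σ (l a) = (∑ i, (l.idxFun i).elim 0 fun c => ((e c : ℕ) : ZMod N)) +
      (e a : ℕ) * (#s : ZMod N) := by
    intro a
    rw [hs, Finset.card_filter, Nat.cast_sum, Finset.mul_sum, ← Finset.sum_add_distrib]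
    refine Finset.sum_congr rfl fun i _ => ?_
    cases hi : l.idxFun i <;> simp [Line.coe_apply, hi]
  refine ⟨b + ∑ i, (l.idxFun i).elim 0 fun c => ((e c : ℕ) : ZMod N), (#s : ZMod N), ?_, ?_⟩
  · rw [Ne, ZMod.natCast_eq_zero_iff]
    intro hdvd
    have hpos : 0 < #s := Finset.card_pos.2 ⟨l.proper.choose, by simp [hs, l.proper.choose_spec]⟩
    have hle : #s ≤ n := (Finset.card_le_univ s).trans_eq (Fintype.card_fin n)
    have := Nat.le_of_dvd hpos hdvd
    omega
  · intro j hj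
    have := hl (e.symm ⟨j, by omega⟩)
    rwa [hσ, e.apply_symm_apply, ← add_assoc] at this

end Szemeredi

/-! ### Hashing finite sets of reals into cyclic groups -/

section Hashing

/-- A homomorphism to `ℚ` that is integral and has trivial kernel on a given finite set. -/
theorem exists_addMonoidHom_integral (s : Finset ℝ) : ∃ (g : ℝ →+ ℚ) (φ : ℝ → ℤ),
    (∀ x ∈ s, (φ x : ℚ) = g x) ∧ ∀ x ∈ s, x ≠ 0 → φ x ≠ 0 := by
  obtain ⟨f, hf⟩ := Module.exists_dual_forall_apply_ne_zero (K := ℚ)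
    (fun x : {x : s // (x : ℝ) ≠ 0} => (x : ℝ)) fun x => x.2
  obtain ⟨b, hb⟩ := IsLocalization.exist_integer_multiples (nonZeroDivisors ℤ) s f
  choose! φ hφ using hb
  have hb0 : ((b : ℤ) : ℚ) ≠ 0 := Int.cast_ne_zero.2 (nonZeroDivisors.ne_zero b.2)
  have hφ' : ∀ x ∈ s, (φ x : ℚ) = (b : ℤ) • f x := fun x hx => by simpa using hφ x hx
  refine ⟨(b : ℤ) • f.toAddMonoidHom, φ, hφ', fun x hx hx0 h => ?_⟩
  have := hφ' x hx
  rw [h, Int.cast_zero, zsmul_eq_mul, eq_comm, mul_eq_zero] at this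
  exact this.elim hb0 (hf ⟨⟨x, hx⟩, hx0⟩)

/-- A finite set of reals admits a map to `ZMod N` that reflects additive quadruples, provided that
`N` is large in terms of the size of the iterated difference set. -/
theorem exists_reflects_quadruples (A : Finset ℝ) (N : ℕ) [NeZero N]
    (hN : 8 * #(A + A - (A + A)) ≤ N) : ∃ ψ : ℝ → ZMod N,
      ∀ a ∈ A, ∀ b ∈ A, ∀ c ∈ A, ∀ d ∈ A, ψ a + ψ b = ψ c + ψ d → a + b = c + d := by
  classical
  set W := A + A - (A + A)
  obtain ⟨g, φ, hg, hφ⟩ := exists_addMonoidHom_integral (A ∪ W)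
  obtain ⟨p, hpW, hp⟩ := Nat.exists_infinite_primes (2 * #W + 1 + ∑ w ∈ W, (φ w).natAbs)
  have := Fact.mk hp
  have hφp : ∀ w ∈ W, w ≠ 0 → ((φ w : ℤ) : ZMod p) ≠ 0 := by
    intro w hw hw0 h
    rw [ZMod.intCast_zmod_eq_zero_iff_dvd, Int.natCast_dvd] at h
    have h1 := Nat.le_of_dvd (Int.natAbs_pos.2 (hφ w (Finset.mem_union_right _ hw) hw0)) h
    have h2 := Finset.single_le_sum (f := fun w => (φ w).natAbs) (fun _ _ => Nat.zero_le _) hw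
    omega
  set M : ℕ := 2 * p / N with hM
  let R : Finset (ZMod p) := (Finset.Icc (-(M : ℤ)) M).image fun m => ((m * N : ℤ) : ZMod p)
  have hR : #R ≤ 2 * M + 1 := Finset.card_image_le.trans (by rw [Int.card_Icc]; omega)
  let bad : Finset (ZMod p) := W.biUnion fun w => R.image fun r => r * ((φ w : ℤ) : ZMod p)⁻¹
  have hbad : #bad < #(Finset.univ : Finset (ZMod p)) := by
    rw [Finset.card_univ, ZMod.card]
    have h1 : #bad ≤ #W * (2 * M + 1) :=
      Finset.card_biUnion_le_card_mul _ _ _ fun w _ => Finset.card_image_le.trans hR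
    have h2 : 8 * #W * M ≤ 2 * p := (Nat.mul_le_mul_right M hN).trans (Nat.mul_div_le _ _)
    have h3 : 2 * #W < p := by omega
    nlinarith
  obtain ⟨q, -, hq⟩ := Finset.exists_mem_notMem_of_card_lt_card hbad
  let v : ℝ → ℕ := fun a => (q * ((φ a : ℤ) : ZMod p)).val
  have hv : ∀ a, v a < p := fun a => ZMod.val_lt _
  refine ⟨fun a => (v a : ZMod N), fun a ha b hb c hc d hd h => ?_⟩
  by_contra hne
  set w := a + b - (c + d) with hw
  have hw0 : w ≠ 0 := sub_ne_zero.2 hne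
  have hwW : w ∈ W := Finset.sub_mem_sub (Finset.add_mem_add ha hb) (Finset.add_mem_add hc hd)
  have hadd : φ a + φ b - (φ c + φ d) = φ w := by
    have : ((φ a + φ b - (φ c + φ d) : ℤ) : ℚ) = (φ w : ℤ) := by
      push_cast
      rw [hg a (Finset.mem_union_left _ ha), hg b (Finset.mem_union_left _ hb),
        hg c (Finset.mem_union_left _ hc), hg d (Finset.mem_union_left _ hd),
        hg w (Finset.mem_union_right _ hwW), hw, map_sub, map_add, map_add]
    exact_mod_cast this
  have hT : (((v a : ℤ) + v b - (v c + v d) : ℤ) : ZMod N) = 0 := by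
    push_cast
    rw [h, sub_self]
  rw [ZMod.intCast_zmod_eq_zero_iff_dvd] at hT
  obtain ⟨m, hm⟩ := hT
  have hmq : ((m * N : ℤ) : ZMod p) = q * ((φ w : ℤ) : ZMod p) := by
    rw [mul_comm, ← hm, ← hadd]
    simp only [v]
    push_cast
    simp only [ZMod.natCast_val, ZMod.cast_id]
    ring
  refine hq (Finset.mem_biUnion.2 ⟨w, hwW, Finset.mem_image.2 ⟨_,
    Finset.mem_image.2 ⟨m, ?_, hmq⟩, ?_⟩⟩)
  · have ha := hv a
    have hb := hv b
    have hc := hv c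
    have hd := hv d
    have hmM : m.natAbs ≤ M := by
      rw [hM, Nat.le_div_iff_mul_le (NeZero.pos N)]
      have : m.natAbs * N = (N * m).natAbs := by
        rw [Int.natAbs_mul, Int.natAbs_natCast, mul_comm]
      rw [this, ← hm]
      omega
    rw [Finset.mem_Icc]
    omega
  · exact mul_inv_cancel_right₀ (hφp w hwW hw0) q

end Hashing

/-! ### Sets of reals with small difference set -/

section SmallDifference

theorem card_sub_le (A : Finset ℝ) : #(A - A) ≤ 2 * #(diffSet A) + 1 := by
  have hsub : A - A ⊆ diffSet A ∪ -diffSet A ∪ {0} := by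
    intro x hx
    have hx' : -x ∈ A - A := by
      rw [← neg_sub A A]
      exact Finset.neg_mem_neg hx
    rcases lt_trichotomy 0 x with h | h | h
    · simp [diffSet, hx, h]
    · simp [← h]
    · have : -x ∈ diffSet A := Finset.mem_filter.2 ⟨hx', neg_pos.2 h⟩
      simp [this]
  calc #(A - A) ≤ #(diffSet A ∪ -diffSet A) + #{(0 : ℝ)} :=
        (Finset.card_le_card hsub).trans (Finset.card_union_le _ _)
    _ ≤ #(diffSet A) + #(-diffSet A) + 1 := by
        gcongr
        · exact Finset.card_union_le _ _
        · simp
    _ = _ := by rw [Finset.card_neg]; ring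

/-- The Plünnecke-Ruzsa inequality for a set of reals in terms of its positive differences. -/
theorem card_add_sub_add_le {A : Finset ℝ} (hA : A.Nonempty) {c : ℝ}
    (h : (#(diffSet A) : ℝ) ≤ c * #A) :
    (#(A + A - (A + A)) : ℝ) ≤ (2 * c + 1) ^ 4 * #A := by
  have hA0 : (1 : ℝ) ≤ #A := Nat.one_le_cast.2 hA.card_pos
  have hpl : (#(A + A - (A + A)) : ℝ) ≤ (#(A - A) / #A : ℝ) ^ 4 * #A := by
    have := (NNRat.cast_le (K := ℝ)).2
      (Finset.pluennecke_ruzsa_inequality_nsmul_sub_nsmul_sub hA A 2 2)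
    rw [two_nsmul] at this
    push_cast at this
    exact this
  refine hpl.trans ?_
  gcongr
  rw [div_le_iff₀ (by positivity)]
  have : (#(A - A) : ℝ) ≤ 2 * #(diffSet A) + 1 := by exact_mod_cast card_sub_le A
  linarith

theorem exists_ap_of_arith {A : Set ℝ} {k : ℕ} {u : ℕ → ℝ} (hu : ∀ j ≤ k, u j ∈ A)
    (hne : u 0 ≠ u 1) (harith : ∀ j, j + 2 ≤ k → u j + u (j + 2) = u (j + 1) + u (j + 1)) :
    ∃ a δ : ℝ, 0 < δ ∧ ∀ j : ℕ, j < k → a + j * δ ∈ A := by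
  have hlin : ∀ j, j ≤ k → u j = u 0 + j * (u 1 - u 0) := by
    intro j
    induction j using Nat.twoStepInduction with
    | zero => simp
    | one => simp
    | more j h0 h1 =>
      intro hj
      have e0 := h0 (by omega)
      have e1 := h1 (by omega)
      have e2 := harith j hj
      push_cast at e1 ⊢
      linarith
  rcases hne.lt_or_gt with h | h
  · exact ⟨u 0, u 1 - u 0, by linarith, fun j hj => hlin j hj.le ▸ hu j hj.le⟩
  · refine ⟨u k, u 0 - u 1, by linarith, fun j hj => ?_⟩
    have := hu (k - j) (Nat.sub_le _ _)
    rw [hlin _ (Nat.sub_le _ _), Nat.cast_sub hj.le] at this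
    rw [hlin k le_rfl]
    convert this using 1
    ring

/-- For every `k ≥ 3` and `c > 0`, for all sufficiently large `n`, every `n`-element
set `A` of reals with `|A - A| ≤ c·n` contains a `k`-term arithmetic progression. -/
theorem small_diffset_contains_kAP (k : ℕ) (hk : 3 ≤ k) (c : ℝ) (hc : 0 < c) :
    ∃ n₀ : ℕ, ∀ n : ℕ, n₀ ≤ n → ∀ A : Finset ℝ, A.card = n →
      ((diffSet A).card : ℝ) ≤ c * n →
      ∃ a δ : ℝ, 0 < δ ∧ ∀ j : ℕ, j < k → a + j * δ ∈ A := by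
  obtain ⟨N₀, hN₀⟩ := exists_ap_zmod k (δ := 1 / (8 * (2 * c + 1) ^ 4)) (by positivity)
  refine ⟨N₀ + 1, fun n hn A hAn hA => ?_⟩
  subst hAn
  have hne : A.Nonempty := Finset.card_pos.1 (by omega)
  set W := A + A - (A + A)
  have hAW : #A ≤ #W :=
    (Finset.card_le_card_add_right hne).trans (Finset.card_le_card_sub_right (hne.add hne))
  have : NeZero (8 * #W) := ⟨by omega⟩
  obtain ⟨ψ, hψ⟩ := exists_reflects_quadruples A (8 * #W) le_rfl
  have hinj : Set.InjOn ψ A := fun a ha b hb hab =>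
    add_right_cancel (hψ a ha b hb b hb b hb (by rw [hab]))
  have hdens : 1 / (8 * (2 * c + 1) ^ 4) ≤ avg (ind (Set.image ψ A)) := by
    have hsum : ∑ x, ind (Set.image ψ A) x = #A := by
      classical
      rw [← Finset.card_image_of_injOn hinj, ← Finset.coe_image]
      simp only [ind, Set.indicator_apply, Finset.mem_coe, Pi.one_apply, Finset.sum_boole,
        Finset.filter_univ_mem]
    have hW0 : (0 : ℝ) < #W := by exact_mod_cast hne.card_pos.trans_le hAW
    rw [avg_eq_sum, ZMod.card, hsum, div_le_div_iff₀ (by positivity) (by push_cast; positivity)]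
    push_cast
    linarith [card_add_sub_add_le hne hA]
  obtain ⟨b, d, hd, hbd⟩ := hN₀ (8 * #W) (by omega) _ hdens
  choose! u hu using hbd
  refine exists_ap_of_arith (A := (A : Set ℝ)) (fun j hj => (hu j hj).1) (fun h => hd ?_)
    fun j hj => hψ _ (hu _ ?_).1 _ (hu _ ?_).1 _ (hu _ ?_).1 _ (hu _ ?_).1 ?_
  · have h0 := (hu 0 (by omega)).2
    have h1 := (hu 1 (by omega)).2
    rw [h, h1] at h0
    simpa using h0
  any_goals omega
  rw [(hu j (by omega)).2, (hu (j + 1) (by omega)).2, (hu (j + 2) hj).2]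
  push_cast
  ring

end SmallDifference
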